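/- Let J be an at most countable index set, let {T_j=(V_j,p_j)}_{j∈J} be pairwise disjoint rooted directed trees with roots ω_j, and let λ_v (v ∈ ⋃_j V_j) be complex numbers such that for each j the weighted shift S_j := S_{λ→_{ω_j}} on T_j is proper and bounded. Then the following are equivalent: (a) one can choose nonzero weights λ̃_{ω_j} (j ∈ J) such that the weighted shift S_λ̃ on the rooted sum of the T_j's — with weight 0 at the new root ω, weight λ̃_{ω_j} at each ω_j, and λ̃_v = λ_v for v ∈ V_j° — is a proper bounded power hyponormal weighted shift; (b) sup_{j∈J} ‖S_j‖ < ∞ and for every j ∈ J the weighted shift S_j admits a power hyponormal 1-step backward extension. -/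

import Mathlib

open scoped ENNReal Classical
noncomputable section

universe u

namespace ShiftsPaper

/-- ℓ²(V) over ℂ. -/
abbrev Hs (V : Type u) : Type u := lp (fun _ : V => ℂ) 2

/-- canonical orthonormal basis vector -/
def ev {V : Type u} (v : V) : Hs V := lp.single 2 v 1

/-- A directed forest: a nonempty vertex set together with a parent function `p`
such that any vertex lying on a `p`-cycle is a fixed point of `p`. -/
def IsDirectedForest {V : Type u} (p : V → V) : Prop :=
  Nonempty V ∧ ∀ n : ℕ, 1 ≤ n → ∀ v : V, p^[n] v = v → p v = v

def rootSet {V : Type u} (p : V → V) : Set V := {v | p v = v}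

def children {V : Type u} (p : V → V) (v : V) : Set V := {u | p u = v ∧ u ≠ v}

/-- the set of `k`-th children `Chi^⟨k⟩(v)` -/
def childrenIter {V : Type u} (p : V → V) : ℕ → V → Set V
  | 0, v => {v}
  | k + 1, v => {u | p^[k + 1] u = v ∧ p^[k] u ≠ v}

/-- descendants -/
def des {V : Type u} (p : V → V) (v : V) : Set V := ⋃ n : ℕ, childrenIter p n v

lemma self_mem_des {V : Type u} (p : V → V) (v : V) : v ∈ des p v :=
  Set.mem_iUnion.2 ⟨0, by simp [childrenIter]⟩

/-- `u` and `v` belong to the same tree (connected component) of the forest -/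
def sameTree {V : Type u} (p : V → V) (u v : V) : Prop :=
  ∃ m n : ℕ, p^[m] u = p^[n] v

/-- A directed tree is a connected directed forest. -/
def IsDirectedTree {V : Type u} (p : V → V) : Prop :=
  IsDirectedForest p ∧ ∀ u v : V, sameTree p u v

def Leafless {V : Type u} (p : V → V) : Prop := Function.Surjective p

def LocallyCountable {V : Type u} (p : V → V) : Prop :=
  ∀ v : V, (children p v).Countable

/-- every non-root vertex has exactly one child -/
def Forkless {V : Type u} (p : V → V) : Prop :=
  ∀ v : V, p v ≠ v → ∃! u : V, u ∈ children p v

/-- a system of weights: vanishing at the roots -/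
def WeightSystem {V : Type u} (p : V → V) (lam : V → ℂ) : Prop :=
  ∀ v : V, p v = v → lam v = 0

/-- a proper system of weights: vanishing exactly at the roots -/
def ProperWeights {V : Type u} (p : V → V) (lam : V → ℂ) : Prop :=
  ∀ v : V, lam v = 0 ↔ p v = v

/-- `S` is the (bounded) weighted shift on the forest `(V, p)` with weights `lam`:
`(S f)(v) = lam v • f (p v)`. -/
def IsWeightedShift {V : Type u} (p : V → V) (lam : V → ℂ)
    (S : Hs V →L[ℂ] Hs V) : Prop :=
  ∀ (f : Hs V) (v : V), (S f : ∀ _ : V, ℂ) v = lam v * (f : ∀ _ : V, ℂ) (p v)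

def Hyponormal {E : Type u} [NormedAddCommGroup E] [InnerProductSpace ℂ E]
    [CompleteSpace E] (A : E →L[ℂ] E) : Prop :=
  (ContinuousLinearMap.adjoint A ∘L A - A ∘L ContinuousLinearMap.adjoint A).IsPositive

def PowerHyponormal {E : Type u} [NormedAddCommGroup E] [InnerProductSpace ℂ E]
    [CompleteSpace E] (A : E →L[ℂ] E) : Prop :=
  ∀ n : ℕ, 1 ≤ n → Hyponormal (A ^ n)

/-- `A` is subnormal: it is the restriction of a bounded normal operator on a larger
Hilbert space to an invariant subspace. -/
def Subnormal {E : Type u} [NormedAddCommGroup E] [InnerProductSpace ℂ E]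
    [CompleteSpace E] (A : E →L[ℂ] E) : Prop :=
  ∃ (K : Type u) (_ : NormedAddCommGroup K) (_ : InnerProductSpace ℂ K)
    (_ : CompleteSpace K) (J : E →ₗᵢ[ℂ] K) (N : K →L[ℂ] K),
    IsStarNormal N ∧ ∀ x : E, N (J x) = J (A x)

/-- `μ` is a representing measure (a positive Borel measure on `[0,∞)`) for the
sequence `a`. -/
def IsRepresentingMeasure (μ : MeasureTheory.Measure ℝ) (a : ℕ → ℝ) : Prop :=
  μ (Set.Iio 0) = 0 ∧
    ∀ n : ℕ, ENNReal.ofReal (a n) = ∫⁻ x : ℝ, ENNReal.ofReal (x ^ n) ∂μ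

def IsStieltjesMomentSeq (a : ℕ → ℝ) : Prop :=
  (∀ n, 0 ≤ a n) ∧ ∃ μ : MeasureTheory.Measure ℝ, IsRepresentingMeasure μ a

/-- parent function of the `k`-step backward extension `T⟨k⟩`; the new vertices
`ω_1, …, ω_k` are encoded as `Sum.inr ⟨0⟩, …, Sum.inr ⟨k-1⟩`. -/
def extParent {V : Type u} (p : V → V) (ω : V) (k : ℕ) :
    V ⊕ Fin k → V ⊕ Fin k
  | Sum.inl v =>
      if v = ω then (if h : 0 < k then Sum.inr ⟨0, h⟩ else Sum.inl ω)
      else Sum.inl (p v)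
  | Sum.inr j =>
      if h : (j : ℕ) + 1 < k then Sum.inr ⟨(j : ℕ) + 1, h⟩ else Sum.inr j

/-- weights on `T⟨k⟩`: weight `mu 0 = λ'_{ω_0}` at the old root `ω`, weight
`mu (j+1) = λ'_{ω_{j+1}}` at `ω_{j+1}` for `j+1 < k`, weight `0` at the new root `ω_k`. -/
def extWeights {V : Type u} (lam : V → ℂ) (ω : V) (k : ℕ) (mu : Fin k → ℂ) :
    V ⊕ Fin k → ℂ
  | Sum.inl v => if v = ω then (if h : 0 < k then mu ⟨0, h⟩ else 0) else lam v
  | Sum.inr j => if h : (j : ℕ) + 1 < k then mu ⟨(j : ℕ) + 1, h⟩ else 0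

/-- `S` (the weighted shift with weights `lam` on a tree rooted at `ω`) admits a
subnormal `k`-step backward extension. -/
def AdmitsSubnormalBackExt {V : Type u} (p : V → V) (lam : V → ℂ) (ω : V)
    (S : Hs V →L[ℂ] Hs V) (k : ℕ) : Prop :=
  Subnormal S ∧
    ∃ mu : Fin k → ℂ, (∀ j, mu j ≠ 0) ∧
      ∃ S' : Hs (V ⊕ Fin k) →L[ℂ] Hs (V ⊕ Fin k),
        IsWeightedShift (extParent p ω k) (extWeights lam ω k mu) S' ∧ Subnormal S'

def AdmitsPowerHypoBackExt {V : Type u} (p : V → V) (lam : V → ℂ) (ω : V)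
    (S : Hs V →L[ℂ] Hs V) (k : ℕ) : Prop :=
  PowerHyponormal S ∧
    ∃ mu : Fin k → ℂ, (∀ j, mu j ≠ 0) ∧
      ∃ S' : Hs (V ⊕ Fin k) →L[ℂ] Hs (V ⊕ Fin k),
        IsWeightedShift (extParent p ω k) (extWeights lam ω k mu) S' ∧
        PowerHyponormal S'

/-- the parent function of the subforest `T|_W`. -/
def restrictParent {V : Type u} (p : V → V) (W : Set V) : W → W :=
  fun v => if h : p ↑v ∈ W then ⟨p ↑v, h⟩ else v

/-- the weights `λ→_u` on the subtree `T_(u→)` of descendants of `u`. -/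
def subWeights {V : Type u} (lam : V → ℂ) (u : V) (W : Set V) : W → ℂ :=
  fun v => if (v : V) = u then 0 else lam ↑v

/-- parent function of the rooted sum of the family `{(V j, p j)}` with roots `ω j`;
the new root is `none`. -/
def rsParent {J : Type u} {V : J → Type u} (p : ∀ j, V j → V j) (ω : ∀ j, V j) :
    Option (Σ j, V j) → Option (Σ j, V j)
  | none => none
  | some ⟨j, v⟩ => if v = ω j then none else some ⟨j, p j v⟩

/-- weights on the rooted sum: `0` at the new root, `θ j` at the old root `ω j`. -/
def rsWeights {J : Type u} {V : J → Type u} (lam : ∀ j, V j → ℂ) (ω : ∀ j, V j)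
    (θ : J → ℂ) : Option (Σ j, V j) → ℂ
  | none => 0
  | some ⟨j, v⟩ => if v = ω j then θ j else lam j v

/-- iterated weights `λ^(k)_v`. -/
def iterWeight {V : Type u} (p : V → V) (lam : V → ℂ) : ℕ → V → ℂ
  | 0, _ => 1
  | k + 1, v => iterWeight p lam k (p v) * lam v

/-- parent function `p^[k]` of the `k`-th power forest `T^k`. -/
def kPowParent {V : Type u} (p : V → V) (k : ℕ) (v : V) : V :=
  if p (p^[k - 1] v) = p^[k - 1] v then v else p^[k] v


open scoped InnerProductSpace

lemma hasSum_sq {V : Type u} (f : Hs V) : HasSum (fun v => ‖f v‖ ^ 2) (‖f‖ ^ 2) := by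
  have h := lp.hasSum_norm (p := 2) (by norm_num) f
  simpa using h

lemma memlp_of_summable {V : Type u} (f : V → ℂ) (h : Summable fun v => ‖f v‖ ^ 2) :
    Memℓp f 2 := by
  apply memℓp_gen
  simpa using h

lemma norm_mono_pt {V W : Type u} (f : Hs V) (g : Hs W) (φ : V → W)
    (hφ : Function.Injective φ) (h : ∀ v, ‖f v‖ ≤ ‖g (φ v)‖) : ‖f‖ ≤ ‖g‖ := by
  have h1 := hasSum_sq f
  have h2 := hasSum_sq g
  have h3 : ‖f‖ ^ 2 ≤ ‖g‖ ^ 2 := by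
    refine hasSum_le_inj φ hφ (fun _ _ => by positivity) (fun v => ?_) h1 h2
    have := h v
    gcongr
  exact (sq_le_sq₀ (norm_nonneg _) (norm_nonneg _)).1 h3

lemma ev_apply {V : Type u} (v w : V) : (ev v : Hs V) w = if w = v then 1 else 0 := by
  unfold ev
  rw [lp.single_apply]
  by_cases h : w = v
  · subst h; simp
  · simp [h]

lemma inner_ev_left {V : Type u} (v : V) (f : Hs V) : ⟪ev v, f⟫_ℂ = f v := by
  unfold ev
  rw [lp.inner_single_left]
  simp

/-- restriction of functions along an injective map -/
def pull {V W : Type u} (φ : W → V) (hφ : Function.Injective φ) : Hs V →L[ℂ] Hs W :=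
  LinearMap.mkContinuous
    { toFun := fun f => ⟨fun w => f (φ w),
        memlp_of_summable _ ((hasSum_sq f).summable.comp_injective hφ)⟩
      map_add' := fun f g => by ext w; rfl
      map_smul' := fun c f => by ext w; rfl } 1
    (fun f => by
      rw [one_mul]
      exact norm_mono_pt _ _ φ hφ (fun v => le_rfl))

lemma pull_apply {V W : Type u} (φ : W → V) (hφ : Function.Injective φ) (f : Hs V) (w : W) :
    (pull φ hφ f) w = f (φ w) := rfl

/-- extension by zero along an injective map -/
def push {V W : Type u} (φ : W → V) (hφ : Function.Injective φ) : Hs W →L[ℂ] Hs V :=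
  ContinuousLinearMap.adjoint (pull φ hφ)

lemma push_apply {V W : Type u} (φ : W → V) (hφ : Function.Injective φ) (f : Hs W) (v : V) :
    (push φ hφ f) v = ⟪pull φ hφ (ev v), f⟫_ℂ := by
  rw [← inner_ev_left, push, ContinuousLinearMap.adjoint_inner_right]

lemma push_range {V W : Type u} (φ : W → V) (hφ : Function.Injective φ) (f : Hs W) (w : W) :
    (push φ hφ f) (φ w) = f w := by
  rw [push_apply, ← inner_ev_left]
  congr 1
  ext w'
  rw [pull_apply, ev_apply, ev_apply, hφ.eq_iff]

lemma push_off {V W : Type u} (φ : W → V) (hφ : Function.Injective φ) (f : Hs W) (v : V)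
    (h : ∀ w, φ w ≠ v) : (push φ hφ f) v = 0 := by
  rw [push_apply]
  have : pull φ hφ (ev v) = 0 := by
    ext w'
    rw [pull_apply, ev_apply, if_neg (h w')]; rfl
  rw [this, inner_zero_left]

lemma pull_push {V W : Type u} (φ : W → V) (hφ : Function.Injective φ) (f : Hs W) :
    pull φ hφ (push φ hφ f) = f := by
  ext w
  rw [pull_apply, push_range]

lemma norm_push {V W : Type u} (φ : W → V) (hφ : Function.Injective φ) (f : Hs W) :
    ‖push φ hφ f‖ = ‖f‖ := by
  have h : ⟪push φ hφ f, push φ hφ f⟫_ℂ = ⟪f, f⟫_ℂ := by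
    conv_lhs => rw [push, ContinuousLinearMap.adjoint_inner_left]
    rw [← push, pull_push]
  rw [inner_self_eq_norm_sq_to_K, inner_self_eq_norm_sq_to_K] at h
  have h' : ‖push φ hφ f‖ ^ 2 = ‖f‖ ^ 2 := by exact_mod_cast h
  exact (sq_eq_sq₀ (norm_nonneg _) (norm_nonneg _)).1 h'

lemma hyponormal_iff {E : Type u} [NormedAddCommGroup E] [InnerProductSpace ℂ E]
    [CompleteSpace E] (A : E →L[ℂ] E) :
    Hyponormal A ↔ ∀ f, ‖ContinuousLinearMap.adjoint A f‖ ≤ ‖A f‖ := by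
  have key : ∀ f, (ContinuousLinearMap.adjoint A ∘L A
      - A ∘L ContinuousLinearMap.adjoint A).reApplyInnerSelf f
      = ‖A f‖ ^ 2 - ‖ContinuousLinearMap.adjoint A f‖ ^ 2 := by
    intro f
    rw [ContinuousLinearMap.reApplyInnerSelf_apply]
    simp only [sub_apply, ContinuousLinearMap.comp_apply, inner_sub_left,
      ContinuousLinearMap.adjoint_inner_left, map_sub]
    rw [← ContinuousLinearMap.adjoint_inner_right A (ContinuousLinearMap.adjoint A f) f, inner_self_eq_norm_sq,
      inner_self_eq_norm_sq]
  unfold Hyponormal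
  rw [ContinuousLinearMap.isPositive_def']
  constructor
  · rintro ⟨-, h⟩ f
    have := h f
    rw [key] at this
    exact (sq_le_sq₀ (norm_nonneg _) (norm_nonneg _)).1 (by linarith)
  · intro h
    refine ⟨?_, fun f => ?_⟩
    · rw [IsSelfAdjoint, star_sub]
      change star (star A * A) - star (A * star A) = star A * A - A * star A
      simp
    · rw [key]
      have := h f
      have : ‖ContinuousLinearMap.adjoint A f‖ ^ 2 ≤ ‖A f‖ ^ 2 := by gcongr
      linarith

lemma pow_shift {V : Type u} (p : V → V) (lam : V → ℂ) (S : Hs V →L[ℂ] Hs V)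
    (h : IsWeightedShift p lam S) (r : V) (hr : lam r = 0) (n : ℕ) :
    ∃ μ : V → ℂ, μ r = 0 ∧ IsWeightedShift (p^[n + 1]) μ (S ^ (n + 1)) := by
  induction n with
  | zero => exact ⟨lam, hr, by simpa using h⟩
  | succ n ih =>
    obtain ⟨μ, hμ, H⟩ := ih
    refine ⟨fun v => lam v * μ (p v), by simp [hr], fun f v => ?_⟩
    rw [pow_succ', mul_apply_eq_comp, h, H, Function.iterate_succ_apply p (n + 1) v]
    ring

/-- It suffices to check hyponormality on functions vanishing at a vertex of weight zero. -/
lemma hypo_of_root {V : Type u} (q : V → V) (μ : V → ℂ) (A : Hs V →L[ℂ] Hs V)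
    (h : IsWeightedShift q μ A) (r : V) (hr : μ r = 0)
    (H : ∀ f : Hs V, f r = 0 → ‖ContinuousLinearMap.adjoint A f‖ ≤ ‖A f‖) : Hyponormal A := by
  rw [hyponormal_iff]
  intro f
  have hadj : ContinuousLinearMap.adjoint A (ev r) = 0 := by
    apply ext_inner_right ℂ
    intro g
    rw [ContinuousLinearMap.adjoint_inner_left, inner_ev_left, h, hr, zero_mul, inner_zero_left]
  set f0 : Hs V := f - f r • ev r with hf0
  have e0 : ∀ v, f0 v = if v = r then 0 else f v := by
    intro v
    have : f0 v = f v - f r * (ev r : Hs V) v := rfl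
    rw [this, ev_apply]
    by_cases hv : v = r
    · subst hv; simp
    · simp [hv]
  have h1 : ContinuousLinearMap.adjoint A f = ContinuousLinearMap.adjoint A f0 := by
    rw [hf0, map_sub, map_smul, hadj, smul_zero, sub_zero]
  rw [h1]
  refine (H f0 (by simp [e0])).trans ?_
  refine norm_mono_pt _ _ id Function.injective_id (fun v => ?_)
  rw [id, h, h, norm_mul, norm_mul, e0]
  gcongr
  split_ifs <;> simp

lemma hypo_compress {E F : Type u} [NormedAddCommGroup E] [InnerProductSpace ℂ E]
    [CompleteSpace E] [NormedAddCommGroup F] [InnerProductSpace ℂ F] [CompleteSpace F]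
    (Q : F →L[ℂ] E) (hQ : ∀ f, ‖ContinuousLinearMap.adjoint Q f‖ = ‖f‖)
    (A : E →L[ℂ] E) (A' : F →L[ℂ] F) (hA : ∀ f, A f = Q (A' (ContinuousLinearMap.adjoint Q f)))
    (hA' : Hyponormal A') (f : E) (hf : ‖A' (ContinuousLinearMap.adjoint Q f)‖ ≤ ‖A f‖) :
    ‖ContinuousLinearMap.adjoint A f‖ ≤ ‖A f‖ := by
  rw [hyponormal_iff] at hA'
  refine le_trans ?_ ((hA' (ContinuousLinearMap.adjoint Q f)).trans hf)
  set g := ContinuousLinearMap.adjoint A f with hg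
  have h1 : ‖g‖ ^ 2 = RCLike.re ⟪ContinuousLinearMap.adjoint A' (ContinuousLinearMap.adjoint Q f),
      ContinuousLinearMap.adjoint Q g⟫_ℂ := by
    rw [ContinuousLinearMap.adjoint_inner_left, ContinuousLinearMap.adjoint_inner_left, ← hA,
      ← ContinuousLinearMap.adjoint_inner_left, ← hg, inner_self_eq_norm_sq]
  have h2 := re_inner_le_norm (𝕜 := ℂ)
    (ContinuousLinearMap.adjoint A' (ContinuousLinearMap.adjoint Q f))
    (ContinuousLinearMap.adjoint Q g)
  rw [← h1, hQ, sq] at h2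
  rcases (norm_nonneg g).eq_or_lt with h0 | h0
  · rw [← h0]; exact norm_nonneg _
  · exact le_of_mul_le_mul_right h2 h0

lemma pow_intertwine {E F : Type u} [NormedAddCommGroup E] [InnerProductSpace ℂ E]
    [NormedAddCommGroup F] [InnerProductSpace ℂ F]
    (A : E →L[ℂ] E) (B : F →L[ℂ] F) (R : E → F) (P : E → Prop) (hP : ∀ f, P f → P (A f))
    (h : ∀ f, P f → R (A f) = B (R f)) (n : ℕ) :
    ∀ f, P f → R ((A ^ n) f) = (B ^ n) (R f) := by
  induction n with
  | zero => intro f _; simp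
  | succ n ih =>
    intro f hf
    rw [pow_succ, mul_apply_eq_comp, ih _ (hP f hf), h f hf, pow_succ,
      mul_apply_eq_comp]

lemma some_inj {J : Type u} {V : J → Type u} (j : J) :
    Function.Injective (fun v : V j => (some ⟨j, v⟩ : Option (Σ j, V j))) := by
  intro a b h
  simpa using h

/-- embedding of the one-step backward extension in the rooted sum -/
def embExt {J : Type u} {V : J → Type u} (j : J) : V j ⊕ Fin 1 → Option (Σ j, V j)
  | Sum.inl v => some ⟨j, v⟩
  | Sum.inr _ => none

lemma embExt_inj {J : Type u} {V : J → Type u} (j : J) :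
    Function.Injective (embExt (V := V) j) := by
  rintro (a | a) (b | b) h
  · simpa [embExt] using h
  · simp [embExt] at h
  · simp [embExt] at h
  · congr 1; exact Subsingleton.elim _ _

lemma embExt_parent {J : Type u} {V : J → Type u} (p : ∀ j, V j → V j) (ω : ∀ j, V j) (j : J)
    (w : V j ⊕ Fin 1) :
    rsParent p ω (embExt j w) = embExt j (extParent (p j) (ω j) 1 w) := by
  rcases w with v | i
  · by_cases h : v = ω j <;> simp [embExt, rsParent, extParent, h]
  · simp [embExt, rsParent, extParent]

lemma embExt_weights {J : Type u} {V : J → Type u} (lam : ∀ j, V j → ℂ) (ω : ∀ j, V j)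
    (θ : J → ℂ) (j : J) (w : V j ⊕ Fin 1) :
    rsWeights lam ω θ (embExt j w) = extWeights (lam j) (ω j) 1 (fun _ => θ j) w := by
  rcases w with v | i
  · by_cases h : v = ω j <;> simp [embExt, rsWeights, extWeights, h]
  · simp [embExt, rsWeights, extWeights]

lemma push_intertwine {J : Type u} {V : J → Type u}
    (p : ∀ j, V j → V j) (ω : ∀ j, V j)
    (lam : ∀ j, V j → ℂ) (hω : ∀ j, lam j (ω j) = 0)
    (S : ∀ j, Hs (V j) →L[ℂ] Hs (V j))
    (hS : ∀ j, IsWeightedShift (p j) (lam j) (S j)) (θ : J → ℂ)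
    (S' : Hs (Option (Σ j, V j)) →L[ℂ] Hs (Option (Σ j, V j)))
    (hS' : IsWeightedShift (rsParent p ω) (rsWeights lam ω θ) S') (j : J) (f : Hs (V j)) :
    push _ (some_inj j) (S j f) = S' (push _ (some_inj j) f) := by
  ext v
  rw [hS']
  rcases v with _ | ⟨i, v⟩
  · rw [push_off _ _ _ none (by simp)]; simp [rsWeights]
  · by_cases hij : i = j
    · subst hij
      have h1 := push_range _ (some_inj i) (S i f) v
      beta_reduce at h1
      rw [h1, hS]
      by_cases hv : v = ω i
      · subst hv
        simp only [rsParent, rsWeights, if_true, hω, zero_mul]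
        rw [push_off _ _ _ none (by simp), mul_zero]
      · have h2 := push_range _ (some_inj i) f (p i v)
        beta_reduce at h2
        simp only [rsParent, rsWeights, if_neg hv]
        rw [h2]
    · have hne : ∀ (u : V i) (w : V j), (some ⟨j, w⟩ : Option (Σ j, V j)) ≠ some ⟨i, u⟩ := by
        intro u w h
        simp only [Option.some.injEq, Sigma.mk.injEq] at h
        exact hij h.1.symm
      rw [push_off _ _ _ _ (hne v)]
      simp only [rsParent]
      split_ifs
      · rw [push_off _ _ _ none (by simp), mul_zero]
      · rw [push_off _ _ _ _ (hne _), mul_zero]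

lemma forward {J : Type u} {V : J → Type u}
    (p : ∀ j, V j → V j) (ω : ∀ j, V j)
    (lam : ∀ j, V j → ℂ) (hω : ∀ j, lam j (ω j) = 0)
    (S : ∀ j, Hs (V j) →L[ℂ] Hs (V j))
    (hS : ∀ j, IsWeightedShift (p j) (lam j) (S j)) (θ : J → ℂ) (hθ : ∀ j, θ j ≠ 0)
    (S' : Hs (Option (Σ j, V j)) →L[ℂ] Hs (Option (Σ j, V j)))
    (hS' : IsWeightedShift (rsParent p ω) (rsWeights lam ω θ) S')
    (hpow : PowerHyponormal S') :
    (∃ C : ℝ, ∀ j, ‖S j‖ ≤ C) ∧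
        ∀ j, AdmitsPowerHypoBackExt (p j) (lam j) (ω j) (S j) 1 := by
  refine ⟨⟨‖S'‖, fun j => ?_⟩, fun j => ⟨?_, ?_⟩⟩
  · refine ContinuousLinearMap.opNorm_le_bound _ (norm_nonneg _) (fun f => ?_)
    rw [← norm_push _ (some_inj (V := V) j) (S j f),
      push_intertwine p ω lam hω S hS θ S' hS', ← norm_push _ (some_inj (V := V) j) f]
    exact S'.le_opNorm _
  · intro n hn
    have hint := fun f => pow_intertwine (S j) S' (push _ (some_inj (V := V) j)) (fun _ => True)
      (fun _ _ => trivial) (fun f _ => push_intertwine p ω lam hω S hS θ S' hS' j f) n f trivial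
    rw [hyponormal_iff]
    intro f
    refine hypo_compress (pull _ (some_inj (V := V) j)) (norm_push _ _) _ (S' ^ n) ?_ (hpow n hn) f
      ?_
    · intro g
      rw [← push, ← hint, pull_push]
    · rw [← push, ← hint, norm_push]
  · set Q := pull _ (embExt_inj (V := V) j) with hQ
    set G := push _ (embExt_inj (V := V) j) with hG
    have hX : IsWeightedShift (extParent (p j) (ω j) 1)
        (extWeights (lam j) (ω j) 1 (fun _ => θ j)) (Q ∘L S' ∘L G) := by
      intro f w
      rw [ContinuousLinearMap.comp_apply, ContinuousLinearMap.comp_apply, pull_apply, hS',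
        embExt_parent, embExt_weights, push_range]
    refine ⟨fun _ => θ j, fun _ => hθ j, Q ∘L S' ∘L G, hX, fun n hn => ?_⟩
    obtain ⟨m, rfl⟩ : ∃ m, n = m + 1 := ⟨n - 1, by omega⟩
    have hw0 : extWeights (lam j) (ω j) 1 (fun _ => θ j) (Sum.inr 0) = 0 := by
      simp [extWeights]
    obtain ⟨μ, hμ, hn'⟩ := pow_shift _ _ _ hX (Sum.inr 0) hw0 m
    have i1 := fun f => pow_intertwine S' (Q ∘L S' ∘L G) Q (fun _ => True)
      (fun _ _ => trivial) (fun f _ => by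
        ext w
        rw [hX, pull_apply, hS', embExt_parent, embExt_weights, pull_apply]) (m + 1) f trivial
    have i2 := pow_intertwine (Q ∘L S' ∘L G) S' G (fun f => f (Sum.inr 0) = 0)
      (fun f _ => by rw [hX, hw0, zero_mul]) (fun f hf => by
        ext v
        by_cases hv : ∃ w, embExt j w = v
        · obtain ⟨w, rfl⟩ := hv
          rw [push_range, hX, hS', embExt_parent, embExt_weights, push_range]
        · push Not at hv
          rw [push_off _ _ _ v hv, hS']
          have h0 : G f none = 0 := by
            have := push_range _ (embExt_inj (V := V) j) f (Sum.inr 0)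
            rw [hf] at this
            exact this
          rcases v with _ | ⟨i, v⟩
          · simp [rsWeights]
          · have hij : i ≠ j := by
              rintro rfl
              exact hv (Sum.inl v) rfl
            simp only [rsParent]
            split_ifs
            · rw [h0, mul_zero]
            · rw [push_off, mul_zero]
              rintro (w | w)
              · intro h
                simp only [embExt, Option.some.injEq, Sigma.mk.injEq] at h
                exact hij h.1.symm
              · simp [embExt]) (m + 1)
    refine hypo_of_root _ _ _ hn' _ hμ (fun f hf => ?_)
    refine hypo_compress Q (norm_push _ _) _ (S' ^ (m + 1)) ?_ (hpow _ hn) f ?_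
    · intro g
      rw [i1, hQ, ← push, pull_push]
    · have h3 := i2 f hf
      change ‖(S' ^ (m + 1)) (G f)‖ ≤ _
      rw [← h3, norm_push]

lemma hasSum_option {α : Type u} {E : Type} [NormedAddCommGroup E]
    (F : Option α → E) (a : E) (h : HasSum F a) :
    HasSum (fun s => F (some s)) (a - F none) := by
  have h1 : HasSum (fun v : Option α => F v - if v = none then F none else 0) (a - F none) :=
    h.sub (hasSum_ite_eq none (F none))
  have h2 := ((Option.some_injective α).hasSum_iff (f := fun v : Option α =>
    F v - if v = none then F none else 0) (a := a - F none) ?_).2 h1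
  · simpa [Function.comp_def] using h2
  · intro x hx
    rcases x with _ | x
    · simp
    · exact absurd ⟨x, rfl⟩ hx

lemma hasSum_pull_inner {J : Type u} {V : J → Type u} (f k : Hs (Option (Σ j, V j))) :
    HasSum (fun j => ⟪pull _ (some_inj (V := V) j) f, pull _ (some_inj (V := V) j) k⟫_ℂ)
      (⟪f, k⟫_ℂ - ⟪f none, k none⟫_ℂ) := by
  have h := hasSum_option _ _ (lp.hasSum_inner (𝕜 := ℂ) f k)
  refine h.sigma (fun j => ?_)
  exact lp.hasSum_inner (𝕜 := ℂ) (pull _ (some_inj (V := V) j) f) (pull _ (some_inj (V := V) j) k)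

lemma hasSum_pull_sq {J : Type u} {V : J → Type u} (f : Hs (Option (Σ j, V j))) :
    HasSum (fun j => ‖pull _ (some_inj (V := V) j) f‖ ^ 2) (‖f‖ ^ 2 - ‖f none‖ ^ 2) := by
  have h := hasSum_option _ _ (hasSum_sq f)
  refine h.sigma (fun j => ?_)
  exact hasSum_sq (pull _ (some_inj (V := V) j) f)

/-- the scaled restriction to the one-step backward extension -/
def rmap {J : Type u} {V : J → Type u} (j : J) (c : ℂ) (f : Hs (Option (Σ j, V j))) :
    Hs (V j ⊕ Fin 1) :=
  pull _ (embExt_inj (V := V) j) f + ((c - 1) * f none) • ev (Sum.inr 0)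

lemma rmap_inl {J : Type u} {V : J → Type u} (j : J) (c : ℂ) (f : Hs (Option (Σ j, V j)))
    (v : V j) : rmap j c f (Sum.inl v) = f (some ⟨j, v⟩) := by
  have : rmap j c f (Sum.inl v) = f (some ⟨j, v⟩)
    + ((c - 1) * f none) * (ev (Sum.inr 0) : Hs (V j ⊕ Fin 1)) (Sum.inl v) := rfl
  rw [this, ev_apply]; simp

lemma rmap_inr {J : Type u} {V : J → Type u} (j : J) (c : ℂ) (f : Hs (Option (Σ j, V j)))
    (i : Fin 1) : rmap j c f (Sum.inr i) = c * f none := by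
  have hi : i = 0 := Subsingleton.elim _ _
  subst hi
  have : rmap j c f (Sum.inr 0) = f none
    + ((c - 1) * f none) * (ev (Sum.inr 0) : Hs (V j ⊕ Fin 1)) (Sum.inr 0) := rfl
  rw [this, ev_apply]; simp; ring

lemma rmap_inner {J : Type u} {V : J → Type u} (j : J) (c : ℂ) (f k : Hs (Option (Σ j, V j))) :
    ⟪rmap j c f, rmap j c k⟫_ℂ
      = ⟪pull _ (some_inj (V := V) j) f, pull _ (some_inj (V := V) j) k⟫_ℂ
        + ⟪c * f none, c * k none⟫_ℂ := by
  refine (lp.hasSum_inner (𝕜 := ℂ) (rmap j c f) (rmap j c k)).unique ?_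
  refine HasSum.sum ?_ ?_
  · have h := lp.hasSum_inner (𝕜 := ℂ) (pull _ (some_inj (V := V) j) f)
      (pull _ (some_inj (V := V) j) k)
    simpa only [Function.comp_def, rmap_inl, pull_apply] using h
  · have h := hasSum_fintype (fun i : Fin 1 => ⟪c * f none, c * k none⟫_ℂ)
    simpa only [Function.comp_def, rmap_inr, Finset.univ_unique, Finset.sum_singleton] using h

lemma rmap_sq {J : Type u} {V : J → Type u} (j : J) (c : ℂ) (f : Hs (Option (Σ j, V j))) :
    ‖rmap j c f‖ ^ 2 = ‖pull _ (some_inj (V := V) j) f‖ ^ 2 + ‖c‖ ^ 2 * ‖f none‖ ^ 2 := by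
  have h := congrArg RCLike.re (rmap_inner j c f f)
  rw [map_add, inner_self_eq_norm_sq, inner_self_eq_norm_sq, inner_self_eq_norm_sq, norm_mul,
    mul_pow] at h
  exact h

/-- existence of the weighted shift on the rooted sum -/
lemma exists_shift {J : Type u} {V : J → Type u}
    (p : ∀ j, V j → V j) (ω : ∀ j, V j)
    (lam : ∀ j, V j → ℂ) (hω : ∀ j, lam j (ω j) = 0)
    (S : ∀ j, Hs (V j) →L[ℂ] Hs (V j))
    (hS : ∀ j, IsWeightedShift (p j) (lam j) (S j)) (C : ℝ) (hC : ∀ j, ‖S j‖ ≤ C)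
    (θ : J → ℂ) (hθ : Summable fun j => ‖θ j‖ ^ 2) :
    ∃ S' : Hs (Option (Σ j, V j)) →L[ℂ] Hs (Option (Σ j, V j)),
      IsWeightedShift (rsParent p ω) (rsWeights lam ω θ) S' := by
  obtain ⟨t, ht⟩ := hθ
  have ht0 : 0 ≤ t := ht.nonneg (fun _ => by positivity)
  set F : Hs (Option (Σ j, V j)) → Option (Σ j, V j) → ℂ :=
    fun f v => rsWeights lam ω θ v * f (rsParent p ω v) with hF
  have hfib : ∀ (f : Hs (Option (Σ j, V j))) (j : J),
      HasSum (fun v : V j => ‖F f (some ⟨j, v⟩)‖ ^ 2)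
        (‖S j (pull _ (some_inj (V := V) j) f)‖ ^ 2 + ‖θ j‖ ^ 2 * ‖f none‖ ^ 2) := by
    intro f j
    have h1 := (hasSum_sq (S j (pull _ (some_inj (V := V) j) f))).add
      (hasSum_ite_eq (ω j) (‖θ j‖ ^ 2 * ‖f none‖ ^ 2))
    convert h1 using 2 with v
    rw [hS, pull_apply]
    by_cases hv : v = ω j
    · subst hv
      simp [hF, rsParent, rsWeights, hω, mul_pow]
    · simp [hF, rsParent, rsWeights, hv]
  have hbd : ∀ f : Hs (Option (Σ j, V j)),
      ∃ a, HasSum (fun v => ‖F f v‖ ^ 2) a ∧ a ≤ (C ^ 2 + t) * ‖f‖ ^ 2 := by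
    intro f
    have hsum : HasSum (fun j => C ^ 2 * ‖pull _ (some_inj (V := V) j) f‖ ^ 2
        + ‖θ j‖ ^ 2 * ‖f none‖ ^ 2) (C ^ 2 * (‖f‖ ^ 2 - ‖f none‖ ^ 2) + t * ‖f none‖ ^ 2) :=
      ((hasSum_pull_sq f).mul_left _).add (ht.mul_right _)
    have hle : ∀ j, ‖S j (pull _ (some_inj (V := V) j) f)‖ ^ 2 + ‖θ j‖ ^ 2 * ‖f none‖ ^ 2
        ≤ C ^ 2 * ‖pull _ (some_inj (V := V) j) f‖ ^ 2 + ‖θ j‖ ^ 2 * ‖f none‖ ^ 2 := by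
      intro j
      have h1 := (S j).le_of_opNorm_le (hC j) (pull _ (some_inj (V := V) j) f)
      have h2 : ‖S j (pull _ (some_inj (V := V) j) f)‖ ^ 2
          ≤ (C * ‖pull _ (some_inj (V := V) j) f‖) ^ 2 := by gcongr
      rw [mul_pow] at h2
      linarith
    have hs : Summable (fun s : Σ j, V j => ‖F f (some s)‖ ^ 2) := by
      rw [summable_sigma_of_nonneg (fun _ => by positivity)]
      refine ⟨fun j => (hfib f j).summable, ?_⟩
      simp only [fun j => (hfib f j).tsum_eq]
      exact Summable.of_nonneg_of_le (fun _ => by positivity) hle hsum.summable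
    obtain ⟨a, ha⟩ := hs
    refine ⟨a, ?_, ?_⟩
    · refine ((Option.some_injective _).hasSum_iff ?_).1 ha
      intro x hx
      rcases x with _ | x
      · simp [hF, rsWeights]
      · exact absurd ⟨x, rfl⟩ hx
    · have h1 := hasSum_le hle (ha.sigma (hfib f)) hsum
      have h2 : ‖f none‖ ^ 2 ≤ ‖f‖ ^ 2 := by
        have := lp.norm_apply_le_norm (p := 2) (by norm_num) f none
        gcongr
      nlinarith [sq_nonneg C, sq_nonneg ‖f none‖]
  have hmem : ∀ f, Memℓp (F f) 2 := fun f => memlp_of_summable _ (hbd f).choose_spec.1.summable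
  refine ⟨LinearMap.mkContinuous
    { toFun := fun f => ⟨F f, hmem f⟩
      map_add' := fun f g => by
        ext v
        change rsWeights lam ω θ v * (f (rsParent p ω v) + g (rsParent p ω v)) =
          rsWeights lam ω θ v * f (rsParent p ω v) + rsWeights lam ω θ v * g (rsParent p ω v)
        ring
      map_smul' := fun c f => by
        ext v
        change rsWeights lam ω θ v * (c * f (rsParent p ω v)) =
          c * (rsWeights lam ω θ v * f (rsParent p ω v))
        ring } (Real.sqrt (C ^ 2 + t)) ?_, fun f v => rfl⟩
  intro f
  obtain ⟨a, ha, hle⟩ := hbd f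
  have h1 := hasSum_sq (⟨F f, hmem f⟩ : Hs (Option (Σ j, V j)))
  have h2 := h1.unique ha
  change ‖(⟨F f, hmem f⟩ : Hs (Option (Σ j, V j)))‖ ≤ _
  rw [← sq_le_sq₀ (norm_nonneg _) (by positivity), h2, mul_pow, Real.sq_sqrt (by positivity)]
  exact hle

lemma backward {J : Type u} [Countable J] {V : J → Type u}
    (p : ∀ j, V j → V j) (ω : ∀ j, V j)
    (lam : ∀ j, V j → ℂ) (hproper : ∀ j, ProperWeights (p j) (lam j))
    (hω : ∀ j, lam j (ω j) = 0)
    (S : ∀ j, Hs (V j) →L[ℂ] Hs (V j))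
    (hS : ∀ j, IsWeightedShift (p j) (lam j) (S j)) (C : ℝ) (hC : ∀ j, ‖S j‖ ≤ C)
    (H : ∀ j, AdmitsPowerHypoBackExt (p j) (lam j) (ω j) (S j) 1) :
    ∃ θ : J → ℂ, (∀ j, θ j ≠ 0) ∧
        ∃ S' : Hs (Option (Σ j, V j)) →L[ℂ] Hs (Option (Σ j, V j)),
          IsWeightedShift (rsParent p ω) (rsWeights lam ω θ) S' ∧
          ProperWeights (rsParent p ω) (rsWeights lam ω θ) ∧
          PowerHyponormal S' := by
  choose _ mu hmu X hX hXp using H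
  obtain ⟨_⟩ := nonempty_encodable J
  obtain ⟨ε, hε, s, hs, hs1⟩ := posSumOfEncodable (ε := 1) one_pos J
  set θ : J → ℂ := fun j => ((Real.sqrt (ε j) * min 1 ‖mu j 0‖ : ℝ) : ℂ) with hθ
  have hmpos : ∀ j, 0 < ‖mu j 0‖ := fun j => norm_pos_iff.2 (hmu j 0)
  have hθpos : ∀ j, 0 < Real.sqrt (ε j) * min 1 ‖mu j 0‖ := fun j =>
    mul_pos (Real.sqrt_pos.2 (hε j)) (lt_min one_pos (hmpos j))
  have hθn : ∀ j, ‖θ j‖ = Real.sqrt (ε j) * min 1 ‖mu j 0‖ := fun j => by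
    rw [hθ, Complex.norm_real, Real.norm_of_nonneg (hθpos j).le]
  have hθ0 : ∀ j, θ j ≠ 0 := fun j => by
    rw [← norm_pos_iff, hθn]; exact hθpos j
  set c : J → ℂ := fun j => θ j / mu j 0 with hc
  have hθε : ∀ j, ‖θ j‖ ^ 2 ≤ ε j := fun j => by
    rw [hθn, mul_pow, Real.sq_sqrt (hε j).le]
    have h1 : min 1 ‖mu j 0‖ ^ 2 ≤ 1 :=
      pow_le_one₀ (lt_min one_pos (hmpos j)).le (min_le_left _ _)
    exact mul_le_of_le_one_right (hε j).le h1
  have hcε : ∀ j, ‖c j‖ ^ 2 ≤ ε j := fun j => by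
    rw [hc, norm_div, div_pow, div_le_iff₀ (by have := hmpos j; positivity), hθn, mul_pow,
      Real.sq_sqrt (hε j).le]
    have h1 : min 1 ‖mu j 0‖ ^ 2 ≤ ‖mu j 0‖ ^ 2 :=
      pow_le_pow_left₀ (lt_min one_pos (hmpos j)).le (min_le_right _ _) 2
    exact mul_le_mul_of_nonneg_left h1 (hε j).le
  obtain ⟨S', hS'⟩ := exists_shift p ω lam hω S hS C hC θ
    (Summable.of_nonneg_of_le (fun _ => by positivity) hθε hs.summable)
  obtain ⟨γ, hγ⟩ := Summable.of_nonneg_of_le (fun _ => by positivity) hcε hs.summable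
  have hγ1 : γ ≤ 1 := (hasSum_le hcε hγ hs).trans hs1
  refine ⟨θ, hθ0, S', hS', ?_, ?_⟩
  · rintro (_ | ⟨j, v⟩)
    · simp [rsWeights, rsParent]
    · by_cases hv : v = ω j
      · simp [rsWeights, rsParent, hv, hθ0]
      · simp [rsWeights, rsParent, hv, hproper j v]
  · intro n hn
    obtain ⟨m, rfl⟩ : ∃ m, n = m + 1 := ⟨n - 1, by omega⟩
    obtain ⟨μ, hμ, hn'⟩ := pow_shift _ _ _ hS' none (by simp [rsWeights]) m
    refine hypo_of_root _ _ _ hn' _ hμ (fun f hf => ?_)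
    have hint : ∀ j g, rmap j (c j) ((S' ^ (m + 1)) g) = (X j ^ (m + 1)) (rmap j (c j) g) :=
      fun j g => pow_intertwine S' (X j) (rmap j (c j)) (fun _ => True)
      (fun _ _ => trivial) (fun g _ => by
        ext w
        rw [hX]
        rcases w with v | i
        · rw [rmap_inl, hS']
          by_cases hv : v = ω j
          · simp only [rsWeights, rsParent, extWeights, extParent, hv, if_true, zero_lt_one,
              dif_pos]
            rw [rmap_inr, hc, ← mul_assoc]
            congr 1
            have : mu j ⟨0, zero_lt_one⟩ = mu j 0 := rfl
            rw [this, mul_div_cancel₀ _ (hmu j 0)]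
          · simp only [rsWeights, rsParent, extWeights, extParent, hv, if_false]
            rw [rmap_inl]
        · rw [rmap_inr, hS']
          simp [rsWeights, extWeights]) (m + 1) g trivial
    set A := S' ^ (m + 1) with hA
    have hsq : ∀ h : Hs (Option (Σ j, V j)), ∃ b, HasSum (fun j => ‖rmap j (c j) h‖ ^ 2) b ∧
        b ≤ ‖h‖ ^ 2 := by
      intro h
      refine ⟨(‖h‖ ^ 2 - ‖h none‖ ^ 2) + γ * ‖h none‖ ^ 2, ?_, ?_⟩
      · simp only [rmap_sq]
        exact (hasSum_pull_sq h).add (hγ.mul_right _)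
      · nlinarith [sq_nonneg ‖h none‖]
    set g := ContinuousLinearMap.adjoint A f with hg
    obtain ⟨b1, hb1, hb1'⟩ := hsq (A f)
    obtain ⟨b2, hb2, hb2'⟩ := hsq g
    have hin : HasSum (fun j => RCLike.re ⟪rmap j (c j) f, rmap j (c j) (A g)⟫_ℂ) (‖g‖ ^ 2) := by
      have h1 := RCLike.hasSum_re ℂ (hasSum_pull_inner f (A g))
      rw [hf, inner_zero_left, sub_zero, ← ContinuousLinearMap.adjoint_inner_left, ← hg,
        inner_self_eq_norm_sq] at h1
      convert h1 using 3 with j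
      rw [rmap_inner, hf, mul_zero, inner_zero_left, add_zero]
    have hle : ∀ j, RCLike.re ⟪rmap j (c j) f, rmap j (c j) (A g)⟫_ℂ
        ≤ (‖rmap j (c j) (A f)‖ ^ 2 + ‖rmap j (c j) g‖ ^ 2) * (1 / 2) := by
      intro j
      rw [hint, hint, ← ContinuousLinearMap.adjoint_inner_left]
      refine (re_inner_le_norm _ _).trans ?_
      have h1 := (hyponormal_iff _).1 (hXp j (m + 1) hn) (rmap j (c j) f)
      have h2 := mul_le_mul_of_nonneg_right h1 (norm_nonneg (rmap j (c j) g))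
      nlinarith [sq_nonneg (‖(X j ^ (m + 1)) (rmap j (c j) f)‖ - ‖rmap j (c j) g‖)]
    have hfin := hasSum_le hle hin ((hb1.add hb2).mul_right (1 / 2))
    rw [← sq_le_sq₀ (norm_nonneg _) (norm_nonneg _)]
    linarith

/-- Theorem (rootsum-powerhypo): a uniformly bounded family of proper weighted shifts
on rooted directed trees can be joined into a proper power hyponormal weighted shift
on the rooted sum iff each member admits a power hyponormal 1-step backward extension
and the family is uniformly bounded. -/
theorem rootSumPowerHypo {J : Type u} [Countable J] {V : J → Type u}
    (p : ∀ j, V j → V j) (ω : ∀ j, V j)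
    (htree : ∀ j, IsDirectedTree (p j)) (hroot : ∀ j, p j (ω j) = ω j)
    (lam : ∀ j, V j → ℂ) (hproper : ∀ j, ProperWeights (p j) (lam j))
    (S : ∀ j, Hs (V j) →L[ℂ] Hs (V j))
    (hS : ∀ j, IsWeightedShift (p j) (lam j) (S j)) :
    (∃ θ : J → ℂ, (∀ j, θ j ≠ 0) ∧
        ∃ S' : Hs (Option (Σ j, V j)) →L[ℂ] Hs (Option (Σ j, V j)),
          IsWeightedShift (rsParent p ω) (rsWeights lam ω θ) S' ∧
          ProperWeights (rsParent p ω) (rsWeights lam ω θ) ∧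
          PowerHyponormal S') ↔
      ((∃ C : ℝ, ∀ j, ‖S j‖ ≤ C) ∧
        ∀ j, AdmitsPowerHypoBackExt (p j) (lam j) (ω j) (S j) 1) := by
  have hω : ∀ j, lam j (ω j) = 0 := fun j => (hproper j (ω j)).2 (hroot j)
  constructor
  · rintro ⟨θ, hθ, S', hS', -, hpow⟩
    exact forward p ω lam hω S hS θ hθ S' hS' hpow
  · rintro ⟨⟨C, hC⟩, H⟩
    exact backward p ω lam hproper hω S hS C hC H

end ShiftsPaper
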